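/- arXiv:2212.12725 — 9 statements merged into one kernel-verified Lean document; each statement's English description precedes it below -/
import Mathlib

section
/- There exists a continuously differentiable function ψ : [0,T] → ℝ satisfying the scalar Riccati terminal-value problem, i.e. ψ'(t) − κ ψ(t) + (1/2) σ² ψ(t)² − μ̄² − 2 σ ρ μ̄ ψ(t) − σ² ρ² ψ(t)² = 0 for all t ∈ [0,T] and ψ(T) = 0; moreover this solution satisfies sup_{0 ≤ t ≤ T} |ψ(t)| < ∞. -/
/-- The scalar Riccati terminal-value problem: a continuously differentiable
function `ψ : [0,T] → ℝ` (with derivative `dψ`) satisfying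
`ψ'(t) − κ ψ(t) + (1/2) σ² ψ(t)² − μ̄² − 2 σ ρ μ̄ ψ(t) − σ² ρ² ψ(t)² = 0`
on `[0,T]` with terminal condition `ψ(T) = 0`. -/
def RiccatiTVP (κ σ μb ρ T : ℝ) (ψ dψ : ℝ → ℝ) : Prop :=
  ContinuousOn dψ (Set.Icc 0 T) ∧
  (∀ t ∈ Set.Icc 0 T, HasDerivWithinAt ψ (dψ t) (Set.Icc 0 T) t) ∧
  (∀ t ∈ Set.Icc 0 T,
    dψ t - κ * ψ t + (1/2) * σ^2 * (ψ t)^2 - μb^2 - 2 * σ * ρ * μb * ψ t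
      - σ^2 * ρ^2 * (ψ t)^2 = 0) ∧
  ψ T = 0

/-- Existence of a bounded solution of the scalar Riccati terminal-value problem. -/
theorem riccati_tvp_exists
    (κ σ μb ρ T : ℝ) (hT : 0 < T) (hσ : 0 < σ) (hρ : ρ^2 < 1/2) :
    ∃ ψ dψ : ℝ → ℝ, RiccatiTVP κ σ μb ρ T ψ dψ ∧
      ∃ C : ℝ, ∀ t ∈ Set.Icc 0 T, |ψ t| ≤ C := by
  by_cases hμ : μb = 0
  · refine ⟨fun _ => 0, fun _ => 0, ⟨continuousOn_const, fun t _ => hasDerivWithinAt_const _ _ _,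
      fun t _ => by simp [hμ], rfl⟩, 0, fun t _ => by simp⟩
  have hμ2 : 0 < μb ^ 2 := by positivity
  obtain ⟨a, ha⟩ : ∃ a, a = σ ^ 2 * (1 / 2 - ρ ^ 2) := ⟨_, rfl⟩
  obtain ⟨b, hb⟩ : ∃ b, b = κ + 2 * σ * ρ * μb := ⟨_, rfl⟩
  have ha0 : 0 < a := by
    rw [ha]; exact mul_pos (by positivity) (by linarith)
  have haμ : 0 < a * μb ^ 2 := mul_pos ha0 hμ2
  obtain ⟨p, m, hp, hm, hsum, hprod⟩ :
      ∃ p m : ℝ, 0 < p ∧ m < 0 ∧ p + m = b ∧ p * m = -(a * μb ^ 2) := by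
    have hd : |b| < Real.sqrt (b ^ 2 + 4 * (a * μb ^ 2)) := by
      apply Real.lt_sqrt_of_sq_lt
      rw [sq_abs]; linarith
    have hs := Real.sq_sqrt (show 0 ≤ b ^ 2 + 4 * (a * μb ^ 2) by positivity)
    have h1 := abs_lt.1 hd
    refine ⟨(b + Real.sqrt (b ^ 2 + 4 * (a * μb ^ 2))) / 2,
      (b - Real.sqrt (b ^ 2 + 4 * (a * μb ^ 2))) / 2, by linarith [h1.1], by linarith [h1.2],
      by ring, by nlinarith⟩
  let D : ℝ → ℝ := fun t => p * Real.exp (m * (t - T)) - m * Real.exp (p * (t - T))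
  let N : ℝ → ℝ := fun t => μb ^ 2 * (Real.exp (p * (t - T)) - Real.exp (m * (t - T)))
  have hD : ∀ t, 0 < D t := fun t => by
    have h1 := mul_pos hp (Real.exp_pos (m * (t - T)))
    have h2 := mul_pos (neg_pos.2 hm) (Real.exp_pos (p * (t - T)))
    simp only [D]; linarith
  have he : ∀ c t : ℝ, HasDerivAt (fun t => Real.exp (c * (t - T)))
      (Real.exp (c * (t - T)) * (c * 1)) t := fun c t =>
    (((hasDerivAt_id t).sub_const T).const_mul c).exp
  have hN' : ∀ t, HasDerivAt N (μb ^ 2 * D t + b * N t) t := fun t => by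
    refine (((he p t).sub (he m t)).const_mul (μb ^ 2)).congr_deriv ?_
    simp only [D, N, ← hsum]; ring
  have hD' : ∀ t, HasDerivAt D (a * N t) t := fun t => by
    refine (((he m t).const_mul p).sub ((he p t).const_mul m)).congr_deriv ?_
    simp only [N]
    linear_combination (Real.exp (m * (t - T)) - Real.exp (p * (t - T))) * hprod
  have hψ : ∀ t, HasDerivAt (fun t => N t / D t)
      (μb ^ 2 + b * (N t / D t) - a * (N t / D t) ^ 2) t := fun t => by
    refine ((hN' t).div (hD' t) (hD t).ne').congr_deriv ?_
    have := (hD t).ne'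
    field_simp
  have hc : Continuous (fun t => N t / D t) :=
    continuous_iff_continuousAt.2 fun t => (hψ t).continuousAt
  refine ⟨fun t => N t / D t, fun t => μb ^ 2 + b * (N t / D t) - a * (N t / D t) ^ 2,
    ⟨?_, fun t _ => (hψ t).hasDerivWithinAt, fun t _ => ?_, ?_⟩, ?_⟩
  · exact ((continuous_const.add (continuous_const.mul hc)).sub
      (continuous_const.mul (hc.pow 2))).continuousOn
  · simp only [ha, hb]; ring
  · simp [N]
  · obtain ⟨C, hC⟩ := isCompact_Icc.exists_bound_of_continuousOn (hc.continuousOn (s := Set.Icc 0 T))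
    exact ⟨C, fun t ht => hC t ht⟩
end

section
/- Every continuously differentiable solution ψ : [0,T] → ℝ of the scalar Riccati terminal-value problem satisfies ψ(t) ≤ 0 for all t ∈ [0,T]. -/
/-- Every solution of the scalar Riccati terminal-value problem is nonpositive. -/
theorem riccati_tvp_nonpos
    (κ σ μb ρ T : ℝ) (hT : 0 < T) (hσ : 0 < σ) (hρ : ρ^2 < 1/2)
    (ψ dψ : ℝ → ℝ) (h : RiccatiTVP κ σ μb ρ T ψ dψ) :
    ∀ t ∈ Set.Icc 0 T, ψ t ≤ 0 := by
  obtain ⟨_, hd, he, hT0⟩ := h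
  have hcont : ContinuousOn ψ (Set.Icc 0 T) := fun t ht => (hd t ht).continuousWithinAt
  have hext : Continuous (Set.IccExtend hT.le ((Set.Icc 0 T).domRestrict ψ)) :=
    (continuousOn_iff_continuous_domRestrict.mp hcont).Icc_extend'
  set a : ℝ → ℝ := fun t => (κ + 2 * σ * ρ * μb)
    - σ^2 * (1/2 - ρ^2) * Set.IccExtend hT.le ((Set.Icc 0 T).domRestrict ψ) t with ha
  have hac : Continuous a := by rw [ha]; fun_prop
  have hA : ∀ t, HasDerivAt (fun t => ∫ s in (0:ℝ)..t, a s) (a t) t := fun t =>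
    hac.integral_hasStrictDerivAt 0 t |>.hasDerivAt
  have hat : ∀ t ∈ Set.Icc 0 T, a t = (κ + 2 * σ * ρ * μb) - σ^2 * (1/2 - ρ^2) * ψ t := by
    intro t ht
    simp only [ha, Set.IccExtend_of_mem hT.le _ ht, Set.domRestrict_apply]
  set A : ℝ → ℝ := fun t => ∫ s in (0:ℝ)..t, a s
  have hg : ∀ t ∈ Set.Icc 0 T, HasDerivWithinAt (fun t => ψ t * Real.exp (-A t))
      (μb^2 * Real.exp (-A t)) (Set.Icc 0 T) t := by
    intro t ht
    refine HasDerivWithinAt.congr_deriv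
      ((hd t ht).mul (hA t).neg.exp.hasDerivWithinAt) ?_
    have h1 := he t ht
    have h2 : dψ t = a t * ψ t + μb^2 := by rw [hat t ht]; linarith
    change dψ t * Real.exp (-A t) + ψ t * (Real.exp (-A t) * -a t) = _
    rw [h2]; ring
  have hmono : MonotoneOn (fun t => ψ t * Real.exp (-A t)) (Set.Icc 0 T) := by
    refine monotoneOn_of_hasDerivWithinAt_nonneg (f' := fun t => μb^2 * Real.exp (-A t))
      (convex_Icc 0 T) (fun t ht => (hg t ht).continuousWithinAt) ?_ ?_
    · intro t ht
      exact (hg t (interior_subset ht)).mono interior_subset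
    · intro t _
      positivity
  intro t ht
  have h3 := hmono ht (Set.right_mem_Icc.mpr hT.le) ht.2
  simp only [hT0, zero_mul] at h3
  exact nonpos_of_mul_nonpos_left h3 (Real.exp_pos _)
end

section
/- The function χ₁(t) := −𝔅/(2𝔆) + (𝔇/(2𝔆)) · N(T−t)/D(T−t), t ∈ [0,T], is continuously differentiable on [0,T], satisfies the terminal condition χ₁(T) = 0, and solves the Riccati ordinary differential equation χ₁'(t) + 𝔆 χ₁(t)² + 𝔅 χ₁(t) + 𝔄 = 0 for all t ∈ [0,T]. -/
/-- The explicit function `χ₁` is continuously differentiable on `[0,T]`, vanishes at `T`,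
and solves the Riccati ODE `χ₁' + 𝔆 χ₁² + 𝔅 χ₁ + 𝔄 = 0` on `[0,T]`. -/
theorem chi1_solves_riccati
    (κ σ μb ρ T : ℝ) (hT : 0 < T) (hσ : 0 < σ) (hρ : ρ^2 < 1/2) (hμ : μb ≠ 0)
    (A B C D : ℝ)
    (hA : A = -μb^2) (hB : B = -κ - 2*ρ*σ*μb) (hC : C = (1/2) * σ^2 * (1 - 2*ρ^2))
    (hD : D = Real.sqrt (B^2 - 4*A*C))
    (χ₁ : ℝ → ℝ)
    (hχ₁ : ∀ t : ℝ, χ₁ t = -B / (2*C) + (D / (2*C)) *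
      (((B + D) * Real.exp (-D * (T - t) / 2) + (B - D) * Real.exp (D * (T - t) / 2)) /
       ((B + D) * Real.exp (-D * (T - t) / 2) - (B - D) * Real.exp (D * (T - t) / 2)))) :
    ContDiffOn ℝ 1 χ₁ (Set.Icc 0 T) ∧ χ₁ T = 0 ∧
      ∀ t ∈ Set.Icc 0 T,
        HasDerivWithinAt χ₁ (-(C * (χ₁ t)^2 + B * χ₁ t + A)) (Set.Icc 0 T) t := by
  have hCpos : 0 < C := by
    rw [hC]
    have : 0 < 1 - 2*ρ^2 := by linarith
    positivity
  have hμ2 : 0 < μb^2 := by positivity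
  have hdisc : B^2 < B^2 - 4*A*C := by
    rw [hA]; nlinarith [mul_pos hμ2 hCpos]
  have hD2 : D^2 = B^2 - 4*A*C := by
    rw [hD]; exact Real.sq_sqrt (by nlinarith [sq_nonneg B])
  have habs : |B| < D := by
    rw [hD]; exact Real.lt_sqrt_of_sq_lt (by rw [sq_abs]; exact hdisc)
  obtain ⟨h1, h2⟩ := abs_lt.mp habs
  have hDpos : 0 < D := lt_of_le_of_lt (abs_nonneg B) habs
  have hden : ∀ t : ℝ, (B + D) * Real.exp (-D * (T - t) / 2)
      - (B - D) * Real.exp (D * (T - t) / 2) ≠ 0 := by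
    intro t
    have e1 := mul_pos (show 0 < B + D by linarith) (Real.exp_pos (-D * (T - t) / 2))
    have e2 := mul_pos (show 0 < D - B by linarith) (Real.exp_pos (D * (T - t) / 2))
    apply ne_of_gt
    linarith
  have hfun : χ₁ = fun t => _ := funext hχ₁
  refine ⟨?_, ?_, ?_⟩
  · apply ContDiff.contDiffOn
    rw [hfun]
    refine contDiff_const.add (contDiff_const.mul (ContDiff.div ?_ ?_ hden)) <;> fun_prop
  · rw [hχ₁]
    simp only [sub_self, mul_zero, zero_div, Real.exp_zero, mul_one]
    have : B + D - (B - D) ≠ 0 := by intro h; linarith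
    field_simp
    ring
  · intro t _
    apply HasDerivAt.hasDerivWithinAt
    have hs : HasDerivAt (fun t : ℝ => T - t) (-1) t := by
      simpa using (hasDerivAt_id t).const_sub T
    have hp := (((hs.const_mul (-D)).div_const 2).exp).const_mul (B + D)
    have hq := (((hs.const_mul D).div_const 2).exp).const_mul (B - D)
    have key := (((hp.add hq).div (hp.sub hq) (hden t)).const_mul (D / (2*C))).const_add
      (-B / (2*C))
    have hd := hden t
    rw [hχ₁ t]
    have key2 : HasDerivAt χ₁ _ t := key.congr_of_eventuallyEq
      (Filter.Eventually.of_forall hχ₁)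
    refine key2.congr_deriv ?_
    simp only [Pi.add_apply, Pi.sub_apply]
    have hA' : A = (B^2 - D^2) / (4*C) := by field_simp; linarith
    rw [hA']
    generalize Real.exp (-D * (T - t) / 2) = x at *
    generalize Real.exp (D * (T - t) / 2) = y at *
    field_simp
    ring
end

section
/- The function χ₁(t) := −𝔅/(2𝔆) + (𝔇/(2𝔆)) · N(T−t)/D(T−t) satisfies χ₁(t) ≤ 0 for every t ∈ [0,T], and in fact χ₁(t) < 0 for every t ∈ [0,T). -/
/-- The explicit Riccati solution `χ₁` is nonpositive on `[0,T]` and strictly negative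
on `[0,T)`. -/
theorem chi1_nonpos
    (κ σ μb ρ T : ℝ) (hT : 0 < T) (hσ : 0 < σ) (hρ : ρ^2 < 1/2) (hμ : μb ≠ 0)
    (A B C D : ℝ)
    (hA : A = -μb^2) (hB : B = -κ - 2*ρ*σ*μb) (hC : C = (1/2) * σ^2 * (1 - 2*ρ^2))
    (hD : D = Real.sqrt (B^2 - 4*A*C))
    (χ₁ : ℝ → ℝ)
    (hχ₁ : ∀ t : ℝ, χ₁ t = -B / (2*C) + (D / (2*C)) *
      (((B + D) * Real.exp (-D * (T - t) / 2) + (B - D) * Real.exp (D * (T - t) / 2)) /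
       ((B + D) * Real.exp (-D * (T - t) / 2) - (B - D) * Real.exp (D * (T - t) / 2)))) :
    (∀ t ∈ Set.Icc 0 T, χ₁ t ≤ 0) ∧ ∀ t ∈ Set.Ico 0 T, χ₁ t < 0 := by
  have hC0 : 0 < C := by
    rw [hC]
    have h1 : 0 < 1 - 2*ρ^2 := by linarith
    positivity
  have hm : 0 < μb^2 := by positivity
  have hAC : 0 < μb^2 * C := mul_pos hm hC0
  have hDsq : D^2 = B^2 + 4 * (μb^2 * C) := by
    rw [hD, Real.sq_sqrt]
    · rw [hA]; ring
    · rw [hA]; nlinarith [sq_nonneg B]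
  have hD0 : 0 ≤ D := by rw [hD]; exact Real.sqrt_nonneg _
  have habs : |B| < D := abs_lt_of_sq_lt_sq (by linarith) hD0
  obtain ⟨h1, h2⟩ := abs_lt.mp habs
  have hDp : 0 < D := by linarith
  have key : ∀ t, ∃ P : ℝ, 0 < P ∧ χ₁ t =
      P * (Real.exp (-D * (T - t) / 2) - Real.exp (D * (T - t) / 2)) := by
    intro t
    rw [hχ₁]
    have e1 := Real.exp_pos (-D * (T - t) / 2)
    have e2 := Real.exp_pos (D * (T - t) / 2)
    generalize Real.exp (-D * (T - t) / 2) = x at *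
    generalize Real.exp (D * (T - t) / 2) = y at *
    have hden : 0 < (B + D) * x - (B - D) * y := by
      have := mul_pos (show 0 < B + D by linarith) e1
      have := mul_pos (show 0 < D - B by linarith) e2
      linarith
    refine ⟨(D^2 - B^2) / (2 * C * ((B + D) * x - (B - D) * y)), ?_, ?_⟩
    · have : 0 < D^2 - B^2 := by linarith
      positivity
    · have := hden.ne'
      field_simp
      ring
  constructor
  · rintro t ⟨_, ht⟩
    obtain ⟨P, hP, h⟩ := key t
    rw [h]
    have : Real.exp (-D * (T - t) / 2) ≤ Real.exp (D * (T - t) / 2) :=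
      Real.exp_le_exp.mpr (by nlinarith [mul_nonneg hD0 (sub_nonneg.mpr ht)])
    exact mul_nonpos_of_nonneg_of_nonpos hP.le (by linarith)
  · rintro t ⟨_, ht⟩
    obtain ⟨P, hP, h⟩ := key t
    rw [h]
    have : Real.exp (-D * (T - t) / 2) < Real.exp (D * (T - t) / 2) :=
      Real.exp_lt_exp.mpr (by nlinarith [mul_pos hDp (sub_pos.mpr ht)])
    exact mul_neg_of_pos_of_neg hP (by linarith)
end

section
/- The function χ₁(t) := −𝔅/(2𝔆) + (𝔇/(2𝔆)) · N(T−t)/D(T−t) is the unique continuously differentiable solution on [0,T] of the scalar Riccati terminal-value problem, i.e. of ψ'(t) − κψ(t) + (1/2)σ²ψ(t)² − μ̄² − 2σρμ̄ψ(t) − σ²ρ²ψ(t)² = 0 with ψ(T) = 0: χ₁ solves this problem, and any continuously differentiable solution coincides with χ₁ on [0,T]. -/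
/-- The explicit function `χ₁` is the unique solution of the scalar Riccati
terminal-value problem on `[0,T]`. -/
theorem chi1_unique_riccati_solution
    (κ σ μb ρ T : ℝ) (hT : 0 < T) (hσ : 0 < σ) (hρ : ρ^2 < 1/2) (hμ : μb ≠ 0)
    (A B C D : ℝ)
    (hA : A = -μb^2) (hB : B = -κ - 2*ρ*σ*μb) (hC : C = (1/2) * σ^2 * (1 - 2*ρ^2))
    (hD : D = Real.sqrt (B^2 - 4*A*C))
    (χ₁ : ℝ → ℝ)
    (hχ₁ : ∀ t : ℝ, χ₁ t = -B / (2*C) + (D / (2*C)) *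
      (((B + D) * Real.exp (-D * (T - t) / 2) + (B - D) * Real.exp (D * (T - t) / 2)) /
       ((B + D) * Real.exp (-D * (T - t) / 2) - (B - D) * Real.exp (D * (T - t) / 2)))) :
    (∃ dχ : ℝ → ℝ, RiccatiTVP κ σ μb ρ T χ₁ dχ) ∧
      ∀ ψ dψ : ℝ → ℝ, RiccatiTVP κ σ μb ρ T ψ dψ →
        ∀ t ∈ Set.Icc 0 T, ψ t = χ₁ t := by
  have hCpos : 0 < C := by
    rw [hC]
    have h1 : 0 < σ^2 := by positivity
    have h2 : 0 < 1 - 2*ρ^2 := by linarith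
    positivity
  have hμ2 : 0 < μb^2 := by positivity
  have hlt : B^2 < B^2 - 4*A*C := by
    rw [hA]; nlinarith [mul_pos hμ2 hCpos]
  have hDsq : D^2 = B^2 - 4*A*C := by
    rw [hD]; exact Real.sq_sqrt (by nlinarith [sq_nonneg B])
  have hD0 : 0 ≤ D := by rw [hD]; exact Real.sqrt_nonneg _
  have habs : |B| < D := by
    apply abs_lt_of_sq_lt_sq _ hD0
    rw [hDsq]; exact hlt
  obtain ⟨hB1, hB2⟩ := abs_lt.1 habs
  have hden : ∀ t : ℝ, 0 < (B + D) * Real.exp (-D * (T - t) / 2)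
      - (B - D) * Real.exp (D * (T - t) / 2) := by
    intro t
    have h1 : 0 < (B + D) * Real.exp (-D * (T - t) / 2) :=
      mul_pos (by linarith) (Real.exp_pos _)
    have h2 : 0 < (D - B) * Real.exp (D * (T - t) / 2) :=
      mul_pos (by linarith) (Real.exp_pos _)
    linarith
  have hder : ∀ t : ℝ, HasDerivAt χ₁ (-(A + B * χ₁ t + C * (χ₁ t)^2)) t := by
    intro t
    have hl : HasDerivAt (fun t : ℝ => T - t) (-1) t := by
      simpa using (hasDerivAt_id t).const_sub T
    have e1 := (((hl.const_mul (-D)).div_const 2).exp).const_mul (B + D)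
    have e2 := (((hl.const_mul D).div_const 2).exp).const_mul (B - D)
    have h := (((e1.add e2).div (e1.sub e2) (hden t).ne').const_mul (D / (2*C))).const_add
      (-B / (2*C))
    have hf : χ₁ = _ := funext hχ₁
    rw [hχ₁ t]
    have hd := (hden t).ne'
    rw [hf]
    refine HasDerivAt.congr_deriv h ?_
    simp only [Pi.add_apply, Pi.sub_apply]
    have hA' : A = (B^2 - D^2) / (4*C) := by
      field_simp; linarith
    rw [hA']
    generalize Real.exp (-D * (T - t) / 2) = x at *
    generalize Real.exp (D * (T - t) / 2) = y at *
    field_simp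
    ring
  have hcont : Continuous χ₁ :=
    continuous_iff_continuousAt.2 fun t => (hder t).continuousAt
  have hχT : χ₁ T = 0 := by
    rw [hχ₁ T]
    have hDne : D ≠ 0 := by
      intro h; rw [h] at habs; linarith [abs_nonneg B]
    simp only [sub_self, mul_zero, zero_div, Real.exp_zero, mul_one]
    have : B + D - (B - D) = 2 * D := by ring
    rw [this]
    field_simp
    ring
  refine ⟨⟨fun t => -(A + B * χ₁ t + C * (χ₁ t)^2), ?_, ?_, ?_, hχT⟩, ?_⟩
  · exact Continuous.continuousOn (by fun_prop)
  · intro t _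
    exact (hder t).hasDerivWithinAt
  · intro t _
    simp only [hA, hB, hC]
    ring
  · rintro ψ dψ ⟨_, hψd, hψ, hψT⟩
    have hψc : ContinuousOn ψ (Set.Icc 0 T) := fun t ht => (hψd t ht).continuousWithinAt
    obtain ⟨M₁, hM₁⟩ := isCompact_Icc.exists_bound_of_continuousOn hψc
    obtain ⟨M₂, hM₂⟩ := isCompact_Icc.exists_bound_of_continuousOn
      (hcont.continuousOn (s := Set.Icc 0 T))
    have hT' : T ∈ Set.Icc 0 T := ⟨hT.le, le_rfl⟩
    have hM0 : 0 ≤ max M₁ M₂ := le_max_of_le_left ((norm_nonneg _).trans (hM₁ T hT'))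
    have hK : 0 ≤ |B| + C * (2 * max M₁ M₂) := by positivity
    refine ODE_solution_unique_of_mem_Icc_left (v := fun _ x => -(A + B * x + C * x^2))
      (s := fun _ => {x : ℝ | |x| ≤ max M₁ M₂}) (K := ⟨_, hK⟩) ?_ hψc ?_ ?_
      hcont.continuousOn ?_ ?_ (hψT.trans hχT.symm)
    · intro t _
      apply LipschitzOnWith.of_dist_le_mul
      intro x hx y hy
      simp only [Set.mem_setOf_eq] at hx hy
      rw [Real.dist_eq, Real.dist_eq]
      have h1 : -(A + B * x + C * x^2) - -(A + B * y + C * y^2)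
          = -((B + C * (x + y)) * (x - y)) := by ring
      rw [h1, abs_neg, abs_mul]
      refine mul_le_mul_of_nonneg_right ?_ (abs_nonneg _)
      refine (abs_add_le _ _).trans ?_
      rw [abs_mul, abs_of_pos hCpos]
      change _ ≤ |B| + C * (2 * max M₁ M₂)
      have := abs_add_le x y
      gcongr
      linarith
    · intro t ht
      have ht' : t ∈ Set.Icc 0 T := ⟨ht.1.le, ht.2⟩
      have e : dψ t = -(A + B * ψ t + C * (ψ t)^2) := by
        have := hψ t ht'
        simp only [hA, hB, hC]
        linarith
      rw [← e]
      exact (hψd t ht').mono_of_mem_nhdsWithin (Icc_mem_nhdsLE_of_mem ht)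
    · intro t ht
      exact (hM₁ t ⟨ht.1.le, ht.2⟩).trans (le_max_left _ _)
    · intro t _
      exact (hder t).hasDerivWithinAt
    · intro t ht
      exact (hM₂ t ⟨ht.1.le, ht.2⟩).trans (le_max_right _ _)
end

section
/- Fix additionally a real parameter θ and set 𝔉 := κθ. The function χ₀(t) := 𝔉( −(𝔅/(2𝔆))(T−t) − (1/𝔆) log( D(T−t)/(2𝔇) ) ), t ∈ [0,T], is continuously differentiable, satisfies χ₀(T) = 0, and solves the linear ordinary differential equation χ₀'(t) + 𝔉 χ₁(t) = 0 for all t ∈ [0,T], where χ₁(t) := −𝔅/(2𝔆) + (𝔇/(2𝔆)) · N(T−t)/D(T−t). -/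
/-- The explicit function `χ₀` is continuously differentiable on `[0,T]`, vanishes at `T`,
and solves the linear ODE `χ₀' + 𝔉 χ₁ = 0` on `[0,T]`. -/
theorem chi0_solves_linear_ode
    (κ σ μb ρ T θ : ℝ) (hT : 0 < T) (hσ : 0 < σ) (hρ : ρ^2 < 1/2) (hμ : μb ≠ 0)
    (A B C D F : ℝ)
    (hA : A = -μb^2) (hB : B = -κ - 2*ρ*σ*μb) (hC : C = (1/2) * σ^2 * (1 - 2*ρ^2))
    (hD : D = Real.sqrt (B^2 - 4*A*C)) (hF : F = κ * θ)
    (χ₁ : ℝ → ℝ)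
    (hχ₁ : ∀ t : ℝ, χ₁ t = -B / (2*C) + (D / (2*C)) *
      (((B + D) * Real.exp (-D * (T - t) / 2) + (B - D) * Real.exp (D * (T - t) / 2)) /
       ((B + D) * Real.exp (-D * (T - t) / 2) - (B - D) * Real.exp (D * (T - t) / 2))))
    (χ₀ : ℝ → ℝ)
    (hχ₀ : ∀ t : ℝ, χ₀ t = F * (-(B / (2*C)) * (T - t) - (1/C) *
      Real.log (((B + D) * Real.exp (-D * (T - t) / 2)
        - (B - D) * Real.exp (D * (T - t) / 2)) / (2*D)))) :
    ContDiffOn ℝ 1 χ₀ (Set.Icc 0 T) ∧ χ₀ T = 0 ∧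
      ∀ t ∈ Set.Icc 0 T, HasDerivWithinAt χ₀ (-(F * χ₁ t)) (Set.Icc 0 T) t := by
  have hCpos : 0 < C := by
    rw [hC]
    have : 0 < 1 - 2*ρ^2 := by linarith
    positivity
  have hμ2 : 0 < μb^2 := by positivity
  have hlt : B^2 < B^2 - 4*A*C := by
    rw [hA]
    have := mul_pos hμ2 hCpos
    linarith
  have habs : |B| < D := by
    rw [hD, ← Real.sqrt_sq_eq_abs]
    exact Real.sqrt_lt_sqrt (sq_nonneg B) hlt
  obtain ⟨h1, h2⟩ := abs_lt.mp habs
  have hDpos : 0 < D := lt_of_le_of_lt (abs_nonneg B) habs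
  have hpos : ∀ t : ℝ, 0 < (B + D) * Real.exp (-D * (T - t) / 2)
      - (B - D) * Real.exp (D * (T - t) / 2) := by
    intro t
    have e1 : 0 < (B + D) * Real.exp (-D * (T - t) / 2) :=
      mul_pos (by linarith) (Real.exp_pos _)
    have e2 : 0 < (D - B) * Real.exp (D * (T - t) / 2) :=
      mul_pos (by linarith) (Real.exp_pos _)
    linarith
  have hfun : χ₀ = fun t => F * (-(B / (2*C)) * (T - t) - (1/C) *
      Real.log (((B + D) * Real.exp (-D * (T - t) / 2)
        - (B - D) * Real.exp (D * (T - t) / 2)) / (2*D))) := funext hχ₀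
  refine ⟨?_, ?_, ?_⟩
  · apply ContDiff.contDiffOn
    rw [hfun]
    refine contDiff_const.mul (ContDiff.sub (by fun_prop) (contDiff_const.mul
      (ContDiff.log (by fun_prop) ?_)))
    intro t
    exact (div_pos (hpos t) (by positivity)).ne'
  · rw [hχ₀]
    have : (D + D) / (2 * D) = 1 := by
      field_simp
      ring
    simp [this]
  · intro t _
    apply HasDerivAt.hasDerivWithinAt
    have hs : HasDerivAt (fun t : ℝ => T - t) (-1) t := by
      simpa using (hasDerivAt_id t).const_sub T
    have ha := (((hs.const_mul (-D)).div_const 2).exp).const_mul (B + D)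
    have hb := (((hs.const_mul D).div_const 2).exp).const_mul (B - D)
    have hl := ((ha.sub hb).div_const (2*D)).log (div_pos (hpos t) (by positivity)).ne'
    have hfin := ((hs.const_mul (-(B / (2*C)))).sub (hl.const_mul (1/C))).const_mul F
    rw [hfun, hχ₁]
    refine hfin.congr_deriv ?_
    have hp := (hpos t).ne'
    simp only [Pi.sub_apply]
    generalize Real.exp (-D * (T - t) / 2) = x at *
    generalize Real.exp (D * (T - t) / 2) = y at *
    field_simp
    ring
end

section
/- Fix additionally a real parameter θ and set 𝔉 := κθ. For every t ∈ [0,T] one has the integral representation χ₀(t) = 𝔉 ∫_t^T χ₁(s) ds, where χ₀(t) := 𝔉( −(𝔅/(2𝔆))(T−t) − (1/𝔆) log( D(T−t)/(2𝔇) ) ) and χ₁(t) := −𝔅/(2𝔆) + (𝔇/(2𝔆)) · N(T−t)/D(T−t). -/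
/-- Integral representation `χ₀(t) = 𝔉 ∫_t^T χ₁(s) ds` of the explicit function `χ₀`. -/
theorem chi0_integral_representation
    (κ σ μb ρ T θ : ℝ) (hT : 0 < T) (hσ : 0 < σ) (hρ : ρ^2 < 1/2) (hμ : μb ≠ 0)
    (A B C D F : ℝ)
    (hA : A = -μb^2) (hB : B = -κ - 2*ρ*σ*μb) (hC : C = (1/2) * σ^2 * (1 - 2*ρ^2))
    (hD : D = Real.sqrt (B^2 - 4*A*C)) (hF : F = κ * θ)
    (χ₁ : ℝ → ℝ)
    (hχ₁ : ∀ t : ℝ, χ₁ t = -B / (2*C) + (D / (2*C)) *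
      (((B + D) * Real.exp (-D * (T - t) / 2) + (B - D) * Real.exp (D * (T - t) / 2)) /
       ((B + D) * Real.exp (-D * (T - t) / 2) - (B - D) * Real.exp (D * (T - t) / 2))))
    (χ₀ : ℝ → ℝ)
    (hχ₀ : ∀ t : ℝ, χ₀ t = F * (-(B / (2*C)) * (T - t) - (1/C) *
      Real.log (((B + D) * Real.exp (-D * (T - t) / 2)
        - (B - D) * Real.exp (D * (T - t) / 2)) / (2*D)))) :
    ∀ t ∈ Set.Icc 0 T, χ₀ t = F * ∫ s in t..T, χ₁ s := by
  intro t _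
  have hCpos : 0 < C := by rw [hC]; have : 0 < 1 - 2*ρ^2 := by linarith
                           positivity
  have hm : 0 < μb^2 := by positivity
  have hmC : 0 < μb^2 * C := mul_pos hm hCpos
  have hBD : |B| < D := by
    rw [hD, ← Real.sqrt_sq_eq_abs]
    apply Real.sqrt_lt_sqrt (sq_nonneg B)
    rw [hA]; nlinarith
  obtain ⟨h1, h2⟩ := abs_lt.mp hBD
  have hDpos : 0 < D := lt_of_le_of_lt (abs_nonneg B) hBD
  have hden : ∀ s : ℝ, 0 < (B + D) * Real.exp (-D * (T - s) / 2)
      - (B - D) * Real.exp (D * (T - s) / 2) := by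
    intro s
    have e1 : 0 < (B + D) * Real.exp (-D * (T - s) / 2) :=
      mul_pos (by linarith) (Real.exp_pos _)
    have e2 : 0 < (D - B) * Real.exp (D * (T - s) / 2) :=
      mul_pos (by linarith) (Real.exp_pos _)
    linarith
  have hcont : Continuous χ₁ := by
    rw [funext hχ₁]
    refine continuous_const.add (continuous_const.mul (Continuous.div ?_ ?_ ?_))
    · fun_prop
    · fun_prop
    · exact fun s => (hden s).ne'
  have hderiv : ∀ s : ℝ, HasDerivAt (fun s => (B / (2*C)) * (T - s) + (1/C) *
      Real.log (((B + D) * Real.exp (-D * (T - s) / 2)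
        - (B - D) * Real.exp (D * (T - s) / 2)) / (2*D))) (χ₁ s) s := by
    intro s
    have hl : HasDerivAt (fun s : ℝ => T - s) (-1) s := (hasDerivAt_id s).const_sub T
    have g1 := (((hl.const_mul (-D)).div_const 2).exp).const_mul (B + D)
    have g2 := (((hl.const_mul D).div_const 2).exp).const_mul (B - D)
    have g := ((g1.sub g2).div_const (2*D)).log
      (div_pos (hden s) (by positivity)).ne'
    have h := (hl.const_mul (B / (2*C))).add (g.const_mul (1/C))
    refine h.congr_deriv ?_
    rw [hχ₁ s]
    have hn := (hden s).ne'
    simp only [Pi.sub_apply]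
    generalize Real.exp (-D * (T - s) / 2) = x at *
    generalize Real.exp (D * (T - s) / 2) = y at *
    have := hCpos.ne'
    have := hDpos.ne'
    field_simp
    ring
  rw [intervalIntegral.integral_eq_sub_of_hasDerivAt (fun s _ => hderiv s)
    (hcont.intervalIntegrable _ _), hχ₀ t]
  have h0 : ((B + D) * Real.exp (-D * (T - T) / 2)
        - (B - D) * Real.exp (D * (T - T) / 2)) / (2*D) = 1 := by
    rw [sub_self, mul_zero, mul_zero, zero_div, Real.exp_zero]
    field_simp
    ring
  rw [h0, Real.log_one]
  ring
end

section
/- For every ζ ∈ ℝ^m one has E(ζ) ≥ 0, and E(ζ) = 0 if and only if ζ = ζ* := (σσᵀ)⁻¹( bΔ + (Δ/L) σΛ₁ + (1/S⁰) ση₁ ); in particular ζ* is the unique minimizer of ζ ↦ E(ζ) over ℝ^m. -/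
open Matrix

/-- The drift expression `E` from the verification proof for mean-variance hedging is
nonnegative, vanishes exactly at `ζ*`, and `ζ*` is its unique minimizer. -/
theorem drift_unique_minimizer
    (m : ℕ) (hm : 1 ≤ m)
    (σ : Matrix (Fin m) (Fin m) ℝ) (hσ : IsUnit σ.det)
    (μ : Fin m → ℝ) (r : ℝ)
    (L S0 : ℝ) (hL : 0 < L) (hS0 : 0 < S0) (Δ : ℝ)
    (Λ₁ η₁ : Fin m → ℝ)
    (b φ : Fin m → ℝ)
    (hb : b = μ - r • (1 : Fin m → ℝ)) (hφ : φ = σ⁻¹ *ᵥ b)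
    (E : (Fin m → ℝ) → ℝ)
    (hE : ∀ ζ : Fin m → ℝ, E ζ =
      Δ^2 * ((φ ⬝ᵥ φ) * L + 2 * (φ ⬝ᵥ Λ₁) + (Λ₁ ⬝ᵥ Λ₁) / L)
      + L * (2 * Δ * (φ ⬝ᵥ η₁) / S0 + (η₁ ⬝ᵥ η₁) / S0^2
          + ζ ⬝ᵥ ((σ * σᵀ) *ᵥ ζ)
          - 2 * (ζ ⬝ᵥ (Δ • b + (1 / S0) • (σ *ᵥ η₁))))
      + 2 * Δ * ((1 / S0) * (η₁ ⬝ᵥ Λ₁) - ζ ⬝ᵥ (σ *ᵥ Λ₁)))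
    (ζstar : Fin m → ℝ)
    (hζstar : ζstar =
      (σ * σᵀ)⁻¹ *ᵥ (Δ • b + (Δ / L) • (σ *ᵥ Λ₁) + (1 / S0) • (σ *ᵥ η₁))) :
    (∀ ζ : Fin m → ℝ, 0 ≤ E ζ) ∧
    (∀ ζ : Fin m → ℝ, E ζ = 0 ↔ ζ = ζstar) ∧
    (∀ ζ : Fin m → ℝ, ζ ≠ ζstar → E ζstar < E ζ) := by
  have hb' : b = σ *ᵥ φ := by
    rw [hφ, mulVec_mulVec, mul_nonsing_inv _ hσ, one_mulVec]
  obtain ⟨w, hw⟩ : ∃ w, w = Δ • φ + (Δ / L) • Λ₁ + (1 / S0) • η₁ := ⟨_, rfl⟩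
  have hdet : IsUnit (σ * σᵀ).det := by
    rw [det_mul, det_transpose]
    exact hσ.mul hσ
  have hσw : Δ • b + (Δ / L) • (σ *ᵥ Λ₁) + (1 / S0) • (σ *ᵥ η₁) = σ *ᵥ w := by
    rw [hw, hb', mulVec_add, mulVec_add, mulVec_smul, mulVec_smul, mulVec_smul]
  have key : ∀ ζ, E ζ = L * ((w - σᵀ *ᵥ ζ) ⬝ᵥ (w - σᵀ *ᵥ ζ)) := by
    intro ζ
    have h : ∀ v, ζ ⬝ᵥ (σ *ᵥ v) = (σᵀ *ᵥ ζ) ⬝ᵥ v := by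
      intro v
      rw [dotProduct_mulVec, mulVec_transpose]
    rw [hE, hb', ← mulVec_mulVec, dotProduct_add, dotProduct_smul, dotProduct_smul]
    simp only [h]
    generalize σᵀ *ᵥ ζ = u
    rw [hw]
    simp only [dotProduct_add, add_dotProduct, dotProduct_sub, sub_dotProduct,
      dotProduct_smul, smul_dotProduct, smul_eq_mul]
    rw [dotProduct_comm Λ₁ φ, dotProduct_comm η₁ φ, dotProduct_comm η₁ Λ₁,
      dotProduct_comm φ u, dotProduct_comm Λ₁ u, dotProduct_comm η₁ u]
    field_simp
    ring
  have hnn : ∀ v : Fin m → ℝ, 0 ≤ v ⬝ᵥ v := fun v =>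
    Finset.sum_nonneg fun i _ => mul_self_nonneg (v i)
  have h0 : ∀ ζ, 0 ≤ E ζ := fun ζ => by
    rw [key]
    exact mul_nonneg hL.le (hnn _)
  have hiff : ∀ ζ, E ζ = 0 ↔ ζ = ζstar := by
    intro ζ
    rw [key, mul_eq_zero, or_iff_right hL.ne', dotProduct_self_eq_zero, sub_eq_zero,
      hζstar, hσw]
    constructor
    · intro h
      rw [h, mulVec_mulVec, mulVec_mulVec, Matrix.mul_assoc, nonsing_inv_mul _ hdet, one_mulVec]
    · intro h
      have hs : (σ * σᵀ) *ᵥ ζ = σ *ᵥ w := by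
        rw [h, mulVec_mulVec, mul_nonsing_inv _ hdet, one_mulVec]
      have h2 := congrArg (fun v => σ⁻¹ *ᵥ v) hs
      simp only [← mulVec_mulVec] at h2
      rw [mulVec_mulVec, mulVec_mulVec _ σ⁻¹ σ, nonsing_inv_mul _ hσ, one_mulVec,
        one_mulVec] at h2
      exact h2.symm
  refine ⟨h0, hiff, fun ζ hne => ?_⟩
  rw [(hiff ζstar).2 rfl]
  exact lt_of_le_of_ne (h0 ζ) fun h => hne ((hiff ζ).1 h.symm)
end

section
/- Assume σ_j > 0 and ρ_j² < 1/2 for every j ∈ {1,…,m}. Then there exists a unique continuously differentiable function ψ : [0,T] → ℝ^m such that, for every j, ψ_j'(t) − κ_j ψ_j(t) + (1/2) σ_j² ψ_j(t)² − μ̄_j² − 2 σ_j ρ_j μ̄_j ψ_j(t) − σ_j² ρ_j² ψ_j(t)² = 0 on [0,T] and ψ_j(T) = 0. Moreover sup_{0 ≤ t ≤ T} |ψ_j(t)| < ∞ and ψ_j(t) ≤ 0 for all t ∈ [0,T] and all j. -/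
/-- Explicit solution of the scalar problem. -/
theorem scalar_riccati_exists (T a b c : ℝ) (ha : 0 < a) (hc : 0 ≤ c) :
    ∃ f : ℝ → ℝ, (∀ t, HasDerivAt f (b * f t + c - a * f t ^ 2) t) ∧ f T = 0 ∧
      ∀ t ≤ T, f t ≤ 0 := by
  rcases hc.eq_or_lt with rfl | hc
  · exact ⟨fun _ => 0, fun t => by simpa using hasDerivAt_const t (0:ℝ), rfl, fun _ _ => le_rfl⟩
  have hac : 0 < a * c := mul_pos ha hc
  obtain ⟨p, q, hp, hq, hpq, hb⟩ : ∃ p q : ℝ, 0 < p ∧ 0 < q ∧ p * q = a * c ∧ p - q = b := by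
    have h0 : 0 ≤ b ^ 2 + 4 * (a * c) := by positivity
    have hs := Real.sq_sqrt h0
    have hlt : |b| < Real.sqrt (b ^ 2 + 4 * (a * c)) := by
      apply Real.lt_sqrt_of_sq_lt
      rw [sq_abs]; linarith
    obtain ⟨h1, h2⟩ := abs_lt.1 hlt
    refine ⟨(Real.sqrt (b ^ 2 + 4 * (a * c)) + b) / 2, (Real.sqrt (b ^ 2 + 4 * (a * c)) - b) / 2,
      by linarith, by linarith, by linarith, by ring⟩
  have hden : ∀ t : ℝ, 0 < p * Real.exp (-q * (t - T)) + q * Real.exp (p * (t - T)) :=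
    fun t => by positivity
  refine ⟨fun t => c * (Real.exp (p * (t - T)) - Real.exp (-q * (t - T))) /
    (p * Real.exp (-q * (t - T)) + q * Real.exp (p * (t - T))), fun t => ?_, by simp, ?_⟩
  · have he : ∀ r : ℝ, HasDerivAt (fun t => Real.exp (r * (t - T)))
        (Real.exp (r * (t - T)) * r) t := fun r => by
      have := (((hasDerivAt_id t).sub_const T).const_mul r).exp
      simpa using this
    have h := (((he p).sub (he (-q))).const_mul c).div
      (((he (-q)).const_mul p).add ((he p).const_mul q)) (hden t).ne'
    have hd := (hden t).ne'
    refine h.congr_deriv ?_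
    simp only [Pi.sub_apply, Pi.add_apply]
    clear h
    have hx := Real.exp_pos (p * (t - T))
    have hy := Real.exp_pos (-q * (t - T))
    generalize Real.exp (p * (t - T)) = x at *
    generalize Real.exp (-q * (t - T)) = y at *
    have ha' : a = p * q / c := by field_simp; linarith
    rw [ha', ← hb]
    have hd2 : (p * y + q * x) ^ 2 ≠ 0 := pow_ne_zero 2 hd
    rw [div_eq_iff hd2]
    obtain ⟨d, hdd⟩ : ∃ d, d = p * y + q * x := ⟨_, rfl⟩
    rw [← hdd] at hd ⊢
    field_simp
    rw [hdd]
    ring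
  · intro t ht
    apply div_nonpos_of_nonpos_of_nonneg _ (hden t).le
    apply mul_nonpos_of_nonneg_of_nonpos hc.le
    rw [sub_nonpos, Real.exp_le_exp]
    nlinarith

theorem scalar_riccati_unique (T a b c : ℝ) (f g : ℝ → ℝ)
    (hf : ∀ t ∈ Set.Icc 0 T, HasDerivWithinAt f (b * f t + c - a * f t ^ 2) (Set.Icc 0 T) t)
    (hg : ∀ t ∈ Set.Icc 0 T, HasDerivWithinAt g (b * g t + c - a * g t ^ 2) (Set.Icc 0 T) t)
    (h : f T = g T) : ∀ t ∈ Set.Icc 0 T, f t = g t := by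
  have hfc : ContinuousOn f (Set.Icc 0 T) := fun t ht => (hf t ht).continuousWithinAt
  have hgc : ContinuousOn g (Set.Icc 0 T) := fun t ht => (hg t ht).continuousWithinAt
  have hk : ContinuousOn (fun t => b - a * (f t + g t)) (Set.Icc 0 T) := by fun_prop
  obtain ⟨C, hC⟩ := isCompact_Icc.exists_bound_of_continuousOn hk
  have key := ODE_solution_unique_of_mem_Icc_left (v := fun t x => (b - a * (f t + g t)) * x)
    (s := fun _ => Set.univ) (K := C.toNNReal) (f := fun t => f t - g t) (g := fun _ => 0)
    (a := 0) (b := T) ?_ (hfc.sub hgc) ?_ (fun _ _ => trivial) continuousOn_const ?_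
    (fun _ _ => trivial) (by simp [h])
  · intro t ht
    have := key ht
    simp only at this
    linarith
  · intro t ht
    apply LipschitzWith.lipschitzOnWith
    apply LipschitzWith.of_dist_le_mul
    intro x y
    rw [Real.dist_eq, Real.dist_eq, ← mul_sub, abs_mul]
    gcongr
    exact (hC t (Set.Ioc_subset_Icc_self ht)).trans (Real.le_coe_toNNReal C)
  · intro t ht
    have ht' := Set.Ioc_subset_Icc_self ht
    have := (((hf t ht').sub (hg t ht')).mono_of_mem_nhdsWithin (?_ : Set.Icc 0 T ∈ nhdsWithin t (Set.Iic t))).congr_deriv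
      (show _ = (b - a * (f t + g t)) * (f t - g t) by ring)
    · exact this
    · exact Filter.mem_of_superset (Icc_mem_nhdsLE ht.1) (Set.Icc_subset_Icc le_rfl ht.2)
  · intro t ht
    simpa using hasDerivWithinAt_const t (Set.Iic t) (0:ℝ)

/-- The componentwise scalar Riccati terminal-value problems for a continuously
differentiable function `ψ : [0,T] → ℝ^m` (with derivative `dψ`). -/
def VecRiccatiTVP (m : ℕ) (T : ℝ) (κ σ μb ρ : Fin m → ℝ)
    (ψ dψ : ℝ → Fin m → ℝ) : Prop :=
  ContinuousOn dψ (Set.Icc 0 T) ∧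
  (∀ t ∈ Set.Icc (0:ℝ) T, HasDerivWithinAt ψ (dψ t) (Set.Icc 0 T) t) ∧
  (∀ j : Fin m, ∀ t ∈ Set.Icc (0:ℝ) T,
    dψ t j - κ j * ψ t j + (1/2) * (σ j)^2 * (ψ t j)^2 - (μb j)^2
      - 2 * (σ j) * (ρ j) * (μb j) * ψ t j
      - (σ j)^2 * (ρ j)^2 * (ψ t j)^2 = 0) ∧
  (∀ j : Fin m, ψ T j = 0)

/-- Existence and uniqueness of the bounded nonpositive solution of the system of
componentwise scalar Riccati terminal-value problems. -/
theorem vec_riccati_exists_unique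
    (m : ℕ) (hm : 1 ≤ m) (T : ℝ) (hT : 0 < T)
    (κ θ σ μb ρ : Fin m → ℝ)
    (hσ : ∀ j, 0 < σ j) (hρ : ∀ j, (ρ j)^2 < 1/2) :
    ∃ ψ dψ : ℝ → Fin m → ℝ,
      VecRiccatiTVP m T κ σ μb ρ ψ dψ ∧
      (∀ j : Fin m, ∃ C : ℝ, ∀ t ∈ Set.Icc (0:ℝ) T, |ψ t j| ≤ C) ∧
      (∀ j : Fin m, ∀ t ∈ Set.Icc (0:ℝ) T, ψ t j ≤ 0) ∧
      (∀ ψ' dψ' : ℝ → Fin m → ℝ, VecRiccatiTVP m T κ σ μb ρ ψ' dψ' →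
        ∀ t ∈ Set.Icc (0:ℝ) T, ψ' t = ψ t) := by
  have H : ∀ j, ∃ f : ℝ → ℝ, (∀ t, HasDerivAt f ((κ j + 2 * σ j * ρ j * μb j) * f t + (μb j) ^ 2
      - ((σ j) ^ 2 * (1 / 2 - (ρ j) ^ 2)) * f t ^ 2) t) ∧ f T = 0 ∧ ∀ t ≤ T, f t ≤ 0 := fun j =>
    scalar_riccati_exists T _ _ _ (mul_pos (pow_pos (hσ j) 2) (by linarith [hρ j])) (sq_nonneg _)
  choose f hf hfT hfn using H
  have hfc : ∀ j, Continuous (f j) := fun j =>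
    continuous_iff_continuousAt.2 fun t => (hf j t).continuousAt
  refine ⟨fun t j => f j t, fun t j => (κ j + 2 * σ j * ρ j * μb j) * f j t + (μb j) ^ 2
      - ((σ j) ^ 2 * (1 / 2 - (ρ j) ^ 2)) * f j t ^ 2, ⟨?_, ?_, ?_, hfT⟩, ?_, ?_, ?_⟩
  · apply Continuous.continuousOn
    fun_prop
  · intro t _
    exact hasDerivWithinAt_pi.2 fun j => (hf j t).hasDerivWithinAt
  · intro j t _
    ring
  · intro j
    exact isCompact_Icc.exists_bound_of_continuousOn (hfc j).continuousOn
  · exact fun j t ht => hfn j t ht.2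
  · rintro ψ' dψ' ⟨_, hd, he, h0⟩ t ht
    funext j
    refine scalar_riccati_unique T ((σ j) ^ 2 * (1 / 2 - (ρ j) ^ 2)) (κ j + 2 * σ j * ρ j * μb j)
      ((μb j) ^ 2) (fun t => ψ' t j) (f j) (fun t ht => ?_)
      (fun t _ => (hf j t).hasDerivWithinAt) (by rw [hfT]; exact h0 j) t ht
    exact (hasDerivWithinAt_pi.1 (hd t ht) j).congr_deriv (by linear_combination he j t ht)
end
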